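/- For any positive semidefinite Hermitian k×k matrix α of trace 1, the p.p.t. distillable entanglement of the maximally correlated state ρ_α equals H(α₁₁, …, α_kk) − S(α). -/

import Mathlib

open Matrix Filter
open scoped ComplexOrder

noncomputable section

/-- Partial transpose on the second tensor factor:
`ptrans M ((i,j),(k,l)) = M ((i,l),(k,j))`. -/
def ptrans {ι κ : Type*} (M : Matrix (ι × κ) (ι × κ) ℂ) : Matrix (ι × κ) (ι × κ) ℂ :=
  fun x y => M (x.1, y.2) (y.1, x.2)

/-- Fidelity of `K`-state p.p.t. distillation:
the supremum of `Tr(Fρ)` over Hermitian `F` with `0 ≤ F ≤ 1` and `-1/K ≤ F^Γ ≤ 1/K`. -/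
def FGamma {ι κ : Type*} [Fintype ι] [Fintype κ] [DecidableEq ι] [DecidableEq κ]
    (ρ : Matrix (ι × κ) (ι × κ) ℂ) (K : ℝ) : ℝ :=
  sSup {x : ℝ | ∃ F : Matrix (ι × κ) (ι × κ) ℂ,
    F.PosSemidef ∧ (1 - F).PosSemidef ∧
    (((1 / K : ℝ) : ℂ) • 1 - ptrans F).PosSemidef ∧
    (ptrans F + ((1 / K : ℝ) : ℂ) • 1).PosSemidef ∧
    x = ((F * ρ).trace).re}

/-- `n`-fold tensor power of a bipartite matrix, regrouped as a bipartite matrix. -/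
def tpow {ι κ : Type*} (ρ : Matrix (ι × κ) (ι × κ) ℂ) (n : ℕ) :
    Matrix ((Fin n → ι) × (Fin n → κ)) ((Fin n → ι) × (Fin n → κ)) ℂ :=
  fun x y => ∏ i, ρ (x.1 i, x.2 i) (y.1 i, y.2 i)

/-- p.p.t. distillable entanglement. -/
def DGamma {ι κ : Type*} [Fintype ι] [Fintype κ] [DecidableEq ι] [DecidableEq κ]
    (ρ : Matrix (ι × κ) (ι × κ) ℂ) : ℝ :=
  sSup {r : ℝ | 0 ≤ r ∧
    Tendsto (fun n : ℕ => FGamma (tpow ρ n) ((⌊(2 : ℝ) ^ (r * (n : ℝ))⌋ : ℤ) : ℝ))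
      atTop (nhds 1)}

/-- The maximally correlated state `ρ_α = ∑_{i,j} α_{ij} |ii⟩⟨jj|`. -/
def maxCorr {k : ℕ} (α : Matrix (Fin k) (Fin k) ℂ) :
    Matrix (Fin k × Fin k) (Fin k × Fin k) ℂ :=
  fun x y => if x.1 = x.2 ∧ y.1 = y.2 then α x.1 y.1 else 0

section LinearAlgebra

open scoped MatrixOrder

variable {ι : Type*}

section Diagonal

variable [DecidableEq ι]

/-- The diagonal matrix with given real entries. -/
def realDiagonal (f : ι → ℝ) : Matrix ι ι ℂ := diagonal fun i => (f i : ℂ)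

lemma realDiagonal_isHermitian (f : ι → ℝ) : (realDiagonal f).IsHermitian := by
  simp [realDiagonal, IsHermitian, diagonal_conjTranspose, Pi.star_def]

lemma realDiagonal_mono {f g : ι → ℝ} (h : ∀ i, f i ≤ g i) :
    realDiagonal f ≤ realDiagonal g := by
  rw [le_iff, realDiagonal, realDiagonal, diagonal_sub, posSemidef_diagonal_iff]
  intro i
  have := h i
  rw [sub_nonneg]
  exact_mod_cast this

lemma realDiagonal_const (c : ℝ) : realDiagonal (fun _ : ι => c) = (c : ℂ) • 1 := by
  rw [realDiagonal, smul_one_eq_diagonal]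

lemma one_sub_indicator (T : ι → Prop) [DecidablePred T] :
    (1 : Matrix ι ι ℂ) - realDiagonal (fun x => if T x then 1 else 0) =
      realDiagonal (fun x => if ¬ T x then 1 else 0) := by
  rw [realDiagonal, realDiagonal, ← diagonal_one, diagonal_sub]
  congr 1
  ext x
  by_cases h : T x <;> simp [h]

end Diagonal

variable [Fintype ι]

lemma re_trace_mul_nonneg {G A : Matrix ι ι ℂ} (hG : G.PosSemidef) (hA : A.PosSemidef) :
    0 ≤ ((G * A).trace).re := by
  classical
  obtain ⟨B, rfl⟩ := CStarAlgebra.nonneg_iff_eq_star_mul_self.mp (nonneg_iff_posSemidef.mpr hG)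
  have h := (hA.mul_mul_conjTranspose_same B).trace_nonneg
  rw [trace_mul_comm, ← mul_assoc, ← star_eq_conjTranspose] at h
  exact (Complex.le_def.mp h).1

lemma re_trace_mul_mono {G A B : Matrix ι ι ℂ} (hG : G.PosSemidef) (h : A ≤ B) :
    ((G * A).trace).re ≤ ((G * B).trace).re := by
  have := re_trace_mul_nonneg hG (le_iff.mp h)
  rw [mul_sub, trace_sub, Complex.sub_re] at this
  linarith

lemma re_trace_mul_le [DecidableEq ι] {G A : Matrix ι ι ℂ} (hG : (1 - G).PosSemidef)
    (hA : A.PosSemidef) : ((G * A).trace).re ≤ (A.trace).re := by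
  have := re_trace_mul_nonneg hG hA
  rw [sub_mul, trace_sub, Complex.sub_re, one_mul] at this
  linarith

lemma conj_mono {A B : Matrix ι ι ℂ} (h : A ≤ B) (C : Matrix ι ι ℂ) :
    C * A * Cᴴ ≤ C * B * Cᴴ := by
  have := (le_iff.mp h).mul_mul_conjTranspose_same C
  rw [mul_sub, sub_mul] at this
  exact le_iff.mpr this

variable [DecidableEq ι]

/-- The pinching inequality `M ≤ (1 + s²) QMQ + (1 + s⁻²) Q'MQ'`, where `Q' = 1 - Q`. -/
lemma le_weighted_pinching {M Q : Matrix ι ι ℂ} (hM : M.PosSemidef) (hQ : Q.IsHermitian)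
    {s : ℝ} (hs : s ≠ 0) :
    M ≤ ((1 + s ^ 2 : ℝ) : ℂ) • (Q * M * Q) +
      ((1 + (s⁻¹) ^ 2 : ℝ) : ℂ) • ((1 - Q) * M * (1 - Q)) := by
  have h := hM.mul_mul_conjTranspose_same ((s : ℂ) • Q - ((s⁻¹ : ℝ) : ℂ) • (1 - Q))
  have hQ' : Qᴴ = Q := hQ
  have hs' : (s : ℂ) ≠ 0 := by exact_mod_cast hs
  rw [le_iff]
  refine (congrArg PosSemidef ?_).mp h
  simp only [conjTranspose_sub, conjTranspose_smul, hQ', conjTranspose_one, Complex.star_def,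
    Complex.conj_ofReal, sub_mul, mul_sub, smul_mul_assoc, mul_smul_comm, one_mul, mul_one,
    smul_sub, smul_smul]
  push_cast
  have h1 : (s : ℂ) * (s : ℂ)⁻¹ = 1 := mul_inv_cancel₀ hs'
  have h2 : (s : ℂ)⁻¹ * (s : ℂ) = 1 := inv_mul_cancel₀ hs'
  rw [h1, h2]
  module

lemma re_trace_mul_realDiagonal (G : Matrix ι ι ℂ) (f : ι → ℝ) :
    ((G * realDiagonal f).trace).re = ∑ i, (G i i).re * f i := by
  simp [realDiagonal, trace, mul_diagonal]

/-- The matrix with eigenvalues `f` in the eigenbasis given by the columns of `U`. -/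
def spectralMatrix (U : Matrix ι ι ℂ) (f : ι → ℝ) : Matrix ι ι ℂ := U * realDiagonal f * Uᴴ

lemma spectralMatrix_mono (U : Matrix ι ι ℂ) {f g : ι → ℝ} (h : ∀ i, f i ≤ g i) :
    spectralMatrix U f ≤ spectralMatrix U g :=
  conj_mono (realDiagonal_mono h) U

lemma spectralMatrix_const {U : Matrix ι ι ℂ} (hU : U * Uᴴ = 1) (c : ℝ) :
    spectralMatrix U (fun _ => c) = (c : ℂ) • 1 := by
  simp [spectralMatrix, realDiagonal_const, hU]

lemma spectralMatrix_posSemidef (U : Matrix ι ι ℂ) {f : ι → ℝ} (h : ∀ i, 0 ≤ f i) :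
    (spectralMatrix U f).PosSemidef := by
  refine PosSemidef.mul_mul_conjTranspose_same ?_ U
  rw [realDiagonal, posSemidef_diagonal_iff]
  intro i
  exact_mod_cast h i

lemma spectralMatrix_add (U : Matrix ι ι ℂ) (f g : ι → ℝ) :
    spectralMatrix U (fun i => f i + g i) = spectralMatrix U f + spectralMatrix U g := by
  rw [spectralMatrix, spectralMatrix, spectralMatrix, ← add_mul, ← mul_add]
  simp [realDiagonal, diagonal_add]

lemma spectralMatrix_mul {U : Matrix ι ι ℂ} (hU : U * Uᴴ = 1) (f g : ι → ℝ) :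
    spectralMatrix U f * spectralMatrix U g = spectralMatrix U (fun i => f i * g i) := by
  have hU' : Uᴴ * U = 1 := mul_eq_one_comm.mp hU
  calc spectralMatrix U f * spectralMatrix U g
      = U * realDiagonal f * (Uᴴ * U) * realDiagonal g * Uᴴ := by
        simp only [spectralMatrix, mul_assoc]
    _ = spectralMatrix U (fun i => f i * g i) := by
        simp [hU', spectralMatrix, realDiagonal, mul_assoc]

lemma re_trace_spectralMatrix {U : Matrix ι ι ℂ} (hU : U * Uᴴ = 1) (f : ι → ℝ) :
    ((spectralMatrix U f).trace).re = ∑ i, f i := by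
  have hU' : Uᴴ * U = 1 := mul_eq_one_comm.mp hU
  rw [spectralMatrix, trace_mul_comm, ← mul_assoc, hU', re_trace_mul_realDiagonal]
  simp

lemma re_trace_mul_indicator_conj (T : ι → Prop) [DecidablePred T] (M : Matrix ι ι ℂ) :
    ((realDiagonal (fun x => if T x then 1 else 0) * M *
      realDiagonal (fun x => if T x then 1 else 0)).trace).re =
      ∑ x, if T x then (M x x).re else 0 := by
  simp only [re_trace_mul_realDiagonal]
  refine Finset.sum_congr rfl fun x _ => ?_
  by_cases h : T x <;> simp [realDiagonal, diagonal_mul, h]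

/-- One-shot converse bound. -/
lemma re_trace_mul_spectralMatrix_le {U G : Matrix ι ι ℂ} (hU : U * Uᴴ = 1) {l : ι → ℝ}
    (hl : ∀ i, 0 ≤ l i) (hl1 : ∑ i, l i = 1) (hG : G.PosSemidef) (hG1 : (1 - G).PosSemidef)
    {κ a b : ℝ} (hκ : 0 ≤ κ) (ha : 0 ≤ a) (hb : 0 < b) (hGκ : ∀ x, (G x x).re ≤ κ) :
    ((G * spectralMatrix U l).trace).re ≤
      (∑ y, if a < l y then l y else 0) +
      2 * (∑ x, if (spectralMatrix U l x x).re < b then (spectralMatrix U l x x).re else 0) +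
      2 * (a * κ / b) := by
  set A := spectralMatrix U l with hA
  have hApsd : A.PosSemidef := spectralMatrix_posSemidef U hl
  have hp : ∀ x, 0 ≤ (A x x).re := fun x => (Complex.le_def.mp hApsd.diag_nonneg).1
  set M := spectralMatrix U (fun y => if a < l y then 0 else l y) with hM
  set N := spectralMatrix U (fun y => if a < l y then l y else 0) with hN
  have hsplit : A = M + N := by
    rw [hA, hM, hN, ← spectralMatrix_add]
    congr 1
    ext y
    split_ifs <;> simp
  have hMpsd : M.PosSemidef := spectralMatrix_posSemidef U fun y => by
    split_ifs <;> simp [hl]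
  have hNpsd : N.PosSemidef := spectralMatrix_posSemidef U fun y => by
    split_ifs <;> simp [hl]
  have hMa : M ≤ (a : ℂ) • 1 := by
    rw [← spectralMatrix_const hU]
    refine spectralMatrix_mono U fun y => ?_
    split_ifs with h
    · exact ha
    · exact not_lt.mp h
  have hMA : M ≤ A := by
    refine spectralMatrix_mono U fun y => ?_
    split_ifs
    · exact hl y
    · exact le_rfl
  have h1 : ((G * N).trace).re ≤ ∑ y, if a < l y then l y else 0 := by
    rw [← re_trace_spectralMatrix hU]
    exact re_trace_mul_le hG1 hNpsd
  set Q : Matrix ι ι ℂ := realDiagonal (fun x => if b ≤ (A x x).re then 1 else 0) with hQ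
  have hQh : Qᴴ = Q := realDiagonal_isHermitian _
  have hQ' : 1 - Q = realDiagonal (fun x => if ¬ b ≤ (A x x).re then 1 else 0) :=
    one_sub_indicator _
  have hQ'h : (1 - Q)ᴴ = 1 - Q := by simp [hQh]
  have h2 := re_trace_mul_mono hG (le_weighted_pinching hMpsd hQh one_ne_zero)
  have h3 : ((G * (Q * M * Q)).trace).re ≤ a * κ / b := by
    have hm := re_trace_mul_mono hG (conj_mono hMa Q)
    have hQQ : Q * ((a : ℂ) • 1) * Q =
        realDiagonal (fun x => if b ≤ (A x x).re then a else 0) := by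
      rw [mul_smul_comm, mul_one, smul_mul_assoc, hQ, realDiagonal, realDiagonal,
        diagonal_mul_diagonal, ← diagonal_smul]
      congr 1
      ext x
      by_cases h : b ≤ (A x x).re <;> simp [h]
    rw [hQh, hQQ, re_trace_mul_realDiagonal] at hm
    refine hm.trans ?_
    calc ∑ x, (G x x).re * (if b ≤ (A x x).re then a else 0)
        ≤ ∑ x, (a * κ / b) * (A x x).re := by
          refine Finset.sum_le_sum fun x _ => ?_
          split_ifs with h
          · have e : a * κ = (a * κ / b) * b := by field_simp
            calc (G x x).re * a ≤ κ * a := mul_le_mul_of_nonneg_right (hGκ x) ha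
              _ = (a * κ / b) * b := by rw [mul_comm, ← e]
              _ ≤ _ := mul_le_mul_of_nonneg_left h (by positivity)
          · have := hp x
            rw [mul_zero]
            positivity
      _ = a * κ / b := by
          have : ∑ x, (A x x).re = 1 := by
            rw [← hl1, ← re_trace_spectralMatrix hU l, ← hA]
            simp [trace]
          rw [← Finset.mul_sum, this, mul_one]
  have h4 : ((G * ((1 - Q) * M * (1 - Q))).trace).re ≤
      ∑ x, if (A x x).re < b then (A x x).re else 0 := by
    have hpsd := hMpsd.mul_mul_conjTranspose_same (1 - Q)
    rw [hQ'h] at hpsd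
    refine (re_trace_mul_le hG1 hpsd).trans ?_
    have hm := re_trace_mul_mono PosSemidef.one (conj_mono hMA (1 - Q))
    rw [one_mul, one_mul, hQ'h] at hm
    refine hm.trans (le_of_eq ?_)
    rw [hQ', re_trace_mul_indicator_conj]
    simp only [not_le]
  rw [mul_add, mul_smul_comm, mul_smul_comm, trace_add, trace_smul, trace_smul, smul_eq_mul,
    smul_eq_mul, Complex.add_re, Complex.re_ofReal_mul, Complex.re_ofReal_mul] at h2
  rw [hsplit, mul_add, trace_add, Complex.add_re, ← hsplit]
  norm_num at h2
  linarith

/-- One-shot achievability bound. -/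
lemma exists_re_trace_mul_spectralMatrix_ge {U : Matrix ι ι ℂ} (hU : U * Uᴴ = 1) {l : ι → ℝ}
    (hl : ∀ i, 0 ≤ l i) {a b s : ℝ} (ha : 0 < a) (hb : 0 ≤ b) (hs : s ≠ 0) :
    ∃ G : Matrix ι ι ℂ, G.PosSemidef ∧ (1 - G).PosSemidef ∧ (∀ x, (G x x).re ≤ b / a) ∧
      (∑ y, if a ≤ l y then l y else 0) -
        (1 + (s⁻¹) ^ 2) *
          (∑ x, if b < (spectralMatrix U l x x).re then (spectralMatrix U l x x).re else 0) ≤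
      (1 + s ^ 2) * ((G * spectralMatrix U l).trace).re := by
  set A := spectralMatrix U l with hA
  have hApsd : A.PosSemidef := spectralMatrix_posSemidef U hl
  set P := spectralMatrix U (fun y => if a ≤ l y then 1 else 0) with hP
  have hPpsd : P.PosSemidef := spectralMatrix_posSemidef U fun y => by
    split_ifs <;> simp
  have hP1 : P ≤ 1 := by
    have h := spectralMatrix_const hU 1
    rw [Complex.ofReal_one, one_smul] at h
    rw [← h]
    refine spectralMatrix_mono U fun y => ?_
    split_ifs <;> simp
  have hPA : (a : ℂ) • P ≤ A := by
    have h : (a : ℂ) • P = spectralMatrix U (fun y => if a ≤ l y then a else 0) := by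
      rw [← mul_one ((a : ℂ) • P), smul_mul_assoc, ← mul_smul_comm, ← spectralMatrix_const hU,
        hP, spectralMatrix_mul hU]
      congr 1
      ext y
      split_ifs <;> simp
    rw [h]
    refine spectralMatrix_mono U fun y => ?_
    split_ifs with h
    · exact h
    · exact hl y
  set Q : Matrix ι ι ℂ := realDiagonal (fun x => if ¬ b < (A x x).re then 1 else 0) with hQ
  have hQh : Qᴴ = Q := realDiagonal_isHermitian _
  have hQ' : 1 - Q = realDiagonal (fun x => if b < (A x x).re then 1 else 0) := by
    rw [hQ, one_sub_indicator]
    simp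
  have hQ'h : (1 - Q)ᴴ = 1 - Q := by simp [hQh]
  have hQP : (Q * P * Q).PosSemidef := by
    have := hPpsd.mul_mul_conjTranspose_same Q
    rwa [hQh] at this
  have hQQ : ∀ T : ι → Prop, ∀ [DecidablePred T], ∀ R : Matrix ι ι ℂ,
      R = realDiagonal (fun x => if T x then 1 else 0) → R * 1 * R = R := by
    intro T _ R hR
    rw [hR, mul_one, realDiagonal, diagonal_mul_diagonal]
    congr 1
    ext x
    split_ifs <;> simp
  have hQle : Q ≤ 1 := by
    rw [← sub_nonneg, hQ', nonneg_iff_posSemidef, realDiagonal, posSemidef_diagonal_iff]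
    intro x
    split_ifs <;> simp
  refine ⟨Q * P * Q, hQP, ?_, ?_, ?_⟩
  · have := conj_mono hP1 Q
    rw [hQh, hQQ _ _ hQ] at this
    exact le_iff.mp (this.trans hQle)
  · intro x
    have hd : a * (P x x).re ≤ (A x x).re := by
      have := (Complex.le_def.mp ((le_iff.mp hPA).diag_nonneg (i := x))).1
      simp only [Matrix.sub_apply, Matrix.smul_apply, smul_eq_mul, Complex.sub_re,
        Complex.re_ofReal_mul, Complex.zero_re] at this
      linarith
    rw [hQ, realDiagonal, mul_diagonal, diagonal_mul]
    split_ifs with h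
    · simpa using div_nonneg hb ha.le
    · have hx : a * (P x x).re ≤ b := hd.trans (not_lt.mp h)
      simpa using (le_div_iff₀' ha).mpr hx
  · have h := re_trace_mul_mono hApsd (le_weighted_pinching hPpsd hQh hs)
    rw [mul_add, mul_smul_comm, mul_smul_comm, trace_add, trace_smul, trace_smul, smul_eq_mul,
      smul_eq_mul, Complex.add_re, Complex.re_ofReal_mul, Complex.re_ofReal_mul,
      hA, hP, spectralMatrix_mul hU, re_trace_spectralMatrix hU, ← hA, ← hP,
      trace_mul_comm A (Q * P * Q)] at h
    have h' : ((A * ((1 - Q) * P * (1 - Q))).trace).re ≤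
        ∑ x, if b < (A x x).re then (A x x).re else 0 := by
      have hm := re_trace_mul_mono hApsd (conj_mono hP1 (1 - Q))
      rw [hQ'h, hQQ _ _ hQ', hQ', re_trace_mul_realDiagonal, ← hQ'] at hm
      refine hm.trans (le_of_eq (Finset.sum_congr rfl fun x _ => ?_))
      split_ifs <;> simp
    have h'' := mul_le_mul_of_nonneg_left h' (by positivity : 0 ≤ 1 + (s⁻¹) ^ 2)
    have hsum : ∑ y, l y * (if a ≤ l y then 1 else 0) = ∑ y, if a ≤ l y then l y else 0 :=
      Finset.sum_congr rfl fun y _ => by split_ifs <;> simp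
    linarith

end LinearAlgebra

section Reduction

lemma normSq_le_of_posSemidef {ι : Type*} {G : Matrix ι ι ℂ} (hG : G.PosSemidef) {κ : ℝ}
    (hκ : ∀ i, (G i i).re ≤ κ) (i j : ι) : Complex.normSq (G i j) ≤ κ ^ 2 := by
  have h := (hG.submatrix ![i, j]).det_nonneg
  have hi := Complex.le_def.mp (hG.diag_nonneg (i := i))
  have hj := Complex.le_def.mp (hG.diag_nonneg (i := j))
  have hji : G j i = star (G i j) := (hG.1.apply j i).symm
  rw [det_fin_two] at h
  simp only [submatrix_apply, cons_val_zero, cons_val_one, hji] at h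
  have h' := (Complex.le_def.mp h).1
  rw [Complex.sub_re, Complex.star_def, Complex.mul_conj, Complex.mul_re, ← hi.2] at h'
  simp only [Complex.zero_re, Complex.zero_im, Complex.ofReal_re, zero_mul, sub_zero] at h' hi hj
  nlinarith [mul_le_mul (hκ i) (hκ j) hj.1 (hi.1.trans (hκ i))]

variable {ι : Type*} [DecidableEq ι]

/-- The maximally correlated matrix `∑ β_{ij} |ii⟩⟨jj|` over an arbitrary index type. -/
def diagEmbed (β : Matrix ι ι ℂ) : Matrix (ι × ι) (ι × ι) ℂ :=
  fun x y => if x.1 = x.2 ∧ y.1 = y.2 then β x.1 y.1 else 0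

/-- The isometry `|i⟩ ↦ |ii⟩`. -/
def diagIsometry (ι : Type*) [DecidableEq ι] : Matrix (ι × ι) ι ℂ :=
  fun x z => if x.1 = z ∧ x.2 = z then 1 else 0

lemma submatrix_diagEmbed (β : Matrix ι ι ℂ) :
    (diagEmbed β).submatrix (fun i => (i, i)) (fun i => (i, i)) = β := by
  ext i j
  simp [diagEmbed]

/-- A feasible operator for the distillation program restricts to a contraction on the diagonal
subspace whose diagonal entries are at most `1 / K`. -/
lemma feasible_submatrix {F : Matrix (ι × ι) (ι × ι) ℂ} {κ : ℝ} (hF : F.PosSemidef)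
    (hF1 : (1 - F).PosSemidef) (hFΓ : ((κ : ℂ) • 1 - ptrans F).PosSemidef) :
    (F.submatrix (fun i : ι => (i, i)) (fun i => (i, i))).PosSemidef ∧
      (1 - F.submatrix (fun i : ι => (i, i)) (fun i => (i, i))).PosSemidef ∧
      ∀ i, (F.submatrix (fun i : ι => (i, i)) (fun i => (i, i)) i i).re ≤ κ := by
  refine ⟨hF.submatrix _, ?_, fun i => ?_⟩
  · have h := hF1.submatrix fun i : ι => (i, i)
    rw [submatrix_sub, Pi.sub_apply, Pi.sub_apply,
      submatrix_one _ fun i j h => congrArg Prod.fst h] at h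
    exact h
  · have h := (Complex.le_def.mp (hFΓ.diag_nonneg (i := (i, i)))).1
    simpa [ptrans] using h

lemma ptrans_diagEmbed_isHermitian {G : Matrix ι ι ℂ} (hG : G.IsHermitian) :
    (ptrans (diagEmbed G)).IsHermitian := by
  ext ⟨a, b⟩ ⟨c, d⟩
  simp only [conjTranspose_apply, ptrans, diagEmbed]
  by_cases h1 : a = d <;> by_cases h2 : c = b <;> simp [h1, h2, eq_comm]
  exact (hG.apply _ _).symm

variable [Fintype ι]

lemma diagEmbed_eq (β : Matrix ι ι ℂ) :
    diagEmbed β = diagIsometry ι * β * (diagIsometry ι)ᴴ := by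
  ext ⟨a, b⟩ ⟨c, d⟩
  simp only [diagEmbed, diagIsometry, mul_apply, conjTranspose_apply, ite_and, ite_mul, one_mul,
    zero_mul, Finset.sum_ite_eq, Finset.mem_univ, if_true, apply_ite star, star_one, star_zero,
    mul_ite, mul_one, mul_zero]
  by_cases h1 : a = b <;> by_cases h2 : c = d <;> simp [h1, h2, eq_comm]

lemma diagEmbed_posSemidef {β : Matrix ι ι ℂ} (hβ : β.PosSemidef) :
    (diagEmbed β).PosSemidef := by
  rw [diagEmbed_eq]
  exact hβ.mul_mul_conjTranspose_same _

lemma one_sub_diagEmbed_posSemidef {β : Matrix ι ι ℂ} (hβ : (1 - β).PosSemidef) :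
    (1 - diagEmbed β).PosSemidef := by
  have h : 1 - diagEmbed β = diagEmbed (1 - β) +
      diagonal (fun x : ι × ι => if x.1 = x.2 then 0 else 1) := by
    ext ⟨a, b⟩ ⟨c, d⟩
    by_cases h1 : a = b <;> by_cases h2 : c = d <;> by_cases h3 : a = c <;> by_cases h4 : b = d <;>
      simp_all [diagEmbed, one_apply]
  rw [h]
  refine (diagEmbed_posSemidef hβ).add ?_
  rw [posSemidef_diagonal_iff]
  intro x
  split_ifs <;> simp

lemma trace_mul_diagEmbed (F : Matrix (ι × ι) (ι × ι) ℂ) (β : Matrix ι ι ℂ) :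
    (F * diagEmbed β).trace = (F.submatrix (fun i => (i, i)) (fun i => (i, i)) * β).trace := by
  simp only [trace, diag_apply, mul_apply, Fintype.sum_prod_type, diagEmbed, submatrix_apply,
    ite_and, mul_ite, mul_zero, Finset.sum_ite_eq, Finset.mem_univ, if_true]
  refine Finset.sum_congr rfl fun i _ => ?_
  rw [Finset.sum_comm]
  simp

lemma ptrans_diagEmbed_mul_self {G : Matrix ι ι ℂ} (hG : G.IsHermitian) :
    ptrans (diagEmbed G) * ptrans (diagEmbed G) =
      diagonal (fun x : ι × ι => (Complex.normSq (G x.1 x.2) : ℂ)) := by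
  ext ⟨a, b⟩ ⟨c, d⟩
  simp only [mul_apply, Fintype.sum_prod_type, ptrans, diagEmbed, diagonal_apply, Prod.mk.injEq,
    ite_and, ite_mul, zero_mul, mul_ite, mul_zero]
  by_cases h1 : a = c <;> by_cases h2 : b = d <;> simp [h1, h2, eq_comm]
  subst h1 h2
  rw [← hG.apply b a, Complex.star_def, Complex.mul_conj]

/-- A Hermitian matrix whose square is at most `κ²` is at most `κ`. -/
lemma smul_one_sub_posSemidef_of_sq {n : Type*} [Fintype n] [DecidableEq n] {M : Matrix n n ℂ}
    (hM : M.IsHermitian) {κ : ℝ} (hκ : 0 < κ)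
    (h : (((κ ^ 2 : ℝ) : ℂ) • 1 - M * M).PosSemidef) : ((κ : ℂ) • 1 - M).PosSemidef := by
  have hh : ((κ : ℂ) • 1 - M)ᴴ = (κ : ℂ) • 1 - M := by
    have hM' : Mᴴ = M := hM
    simp [conjTranspose_sub, conjTranspose_smul, hM']
  have h1 := posSemidef_self_mul_conjTranspose ((κ : ℂ) • 1 - M)
  rw [hh] at h1
  have h2 := (h1.add h).smul (show (0 : ℂ) ≤ (((2 * κ)⁻¹ : ℝ) : ℂ) by
    exact_mod_cast (by positivity : 0 ≤ (2 * κ)⁻¹))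
  refine (congrArg PosSemidef ?_).mp h2
  have hκ' : (κ : ℂ) ≠ 0 := by exact_mod_cast hκ.ne'
  simp only [sub_mul, mul_sub, smul_mul_assoc, mul_smul_comm, one_mul, mul_one]
  push_cast
  match_scalars <;> field_simp <;> ring

lemma ptrans_diagEmbed_bounds {G : Matrix ι ι ℂ} (hG : G.PosSemidef) {κ : ℝ} (hκ0 : 0 < κ)
    (hκ : ∀ i, (G i i).re ≤ κ) :
    ((κ : ℂ) • 1 - ptrans (diagEmbed G)).PosSemidef ∧
      (ptrans (diagEmbed G) + (κ : ℂ) • 1).PosSemidef := by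
  have hsq : (((κ ^ 2 : ℝ) : ℂ) • 1 -
      ptrans (diagEmbed G) * ptrans (diagEmbed G)).PosSemidef := by
    rw [ptrans_diagEmbed_mul_self hG.1, smul_one_eq_diagonal, diagonal_sub,
      posSemidef_diagonal_iff]
    intro x
    rw [sub_nonneg]
    exact_mod_cast normSq_le_of_posSemidef hG hκ x.1 x.2
  have hH := ptrans_diagEmbed_isHermitian hG.1
  refine ⟨smul_one_sub_posSemidef_of_sq hH hκ0 hsq, ?_⟩
  have := smul_one_sub_posSemidef_of_sq hH.neg hκ0 (by rwa [neg_mul_neg])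
  rwa [sub_neg_eq_add, add_comm] at this

lemma FGamma_diagEmbed_le {β : Matrix ι ι ℂ} {K c : ℝ} (hK : 0 < K)
    (h : ∀ G : Matrix ι ι ℂ, G.PosSemidef → (1 - G).PosSemidef → (∀ i, (G i i).re ≤ 1 / K) →
      ((G * β).trace).re ≤ c) : FGamma (diagEmbed β) K ≤ c := by
  have hK' : (0 : ℂ) ≤ ((1 / K : ℝ) : ℂ) := by exact_mod_cast (one_div_pos.mpr hK).le
  refine csSup_le ⟨0, 0, PosSemidef.zero, by simpa using PosSemidef.one, ?_, ?_, by simp⟩ ?_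
  · have h0 : ptrans (0 : Matrix (ι × ι) (ι × ι) ℂ) = 0 := rfl
    rw [h0, sub_zero]
    exact PosSemidef.one.smul hK'
  · have h0 : ptrans (0 : Matrix (ι × ι) (ι × ι) ℂ) = 0 := rfl
    rw [h0, zero_add]
    exact PosSemidef.one.smul hK'
  · rintro x ⟨F, hF, hF1, hFΓ, -, rfl⟩
    rw [trace_mul_diagEmbed]
    obtain ⟨h1, h2, h3⟩ := feasible_submatrix hF hF1 hFΓ
    exact h _ h1 h2 h3

lemma le_FGamma_diagEmbed {β G : Matrix ι ι ℂ} (hβ : β.PosSemidef) {K : ℝ} (hK : 0 < K)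
    (hG : G.PosSemidef) (hG1 : (1 - G).PosSemidef) (hGK : ∀ i, (G i i).re ≤ 1 / K) :
    ((G * β).trace).re ≤ FGamma (diagEmbed β) K := by
  refine le_csSup ⟨(β.trace).re, ?_⟩ ?_
  · rintro x ⟨F, hF, hF1, hFΓ, -, rfl⟩
    rw [trace_mul_diagEmbed]
    exact re_trace_mul_le (feasible_submatrix hF hF1 hFΓ).2.1 hβ
  · obtain ⟨h1, h2⟩ := ptrans_diagEmbed_bounds hG (one_div_pos.mpr hK) hGK
    exact ⟨diagEmbed G, diagEmbed_posSemidef hG, one_sub_diagEmbed_posSemidef hG1, h1, h2, by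
      rw [trace_mul_diagEmbed, submatrix_diagEmbed]⟩

end Reduction

section TensorPower

variable {ι : Type*}

/-- The `n`-fold tensor power of a matrix. -/
def tensorPower (A : Matrix ι ι ℂ) (n : ℕ) : Matrix (Fin n → ι) (Fin n → ι) ℂ :=
  fun x y => ∏ i, A (x i) (y i)

lemma tpow_diagEmbed [DecidableEq ι] (β : Matrix ι ι ℂ) (n : ℕ) :
    tpow (diagEmbed β) n = diagEmbed (tensorPower β n) := by
  ext ⟨a, b⟩ ⟨c, d⟩
  simp only [tpow, diagEmbed, tensorPower, Fintype.prod_ite_zero, forall_and, funext_iff]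

lemma tensorPower_conjTranspose (A : Matrix ι ι ℂ) (n : ℕ) :
    tensorPower Aᴴ n = (tensorPower A n)ᴴ := by
  ext x y
  simp [tensorPower, conjTranspose_apply]

lemma tensorPower_realDiagonal [DecidableEq ι] (f : ι → ℝ) (n : ℕ) :
    tensorPower (realDiagonal f) n = realDiagonal (fun x : Fin n → ι => ∏ i, f (x i)) := by
  ext x y
  simp only [tensorPower, realDiagonal, diagonal_apply, Fintype.prod_ite_zero, funext_iff,
    Complex.ofReal_prod]
  split_ifs <;> rfl

lemma tensorPower_diag_re {A : Matrix ι ι ℂ} (hA : A.PosSemidef) (n : ℕ) (x : Fin n → ι) :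
    (tensorPower A n x x).re = ∏ i, (A (x i) (x i)).re := by
  have h : ∀ i, A i i = ((A i i).re : ℂ) := fun i =>
    Complex.ext (by simp) (by simpa using (Complex.le_def.mp (hA.diag_nonneg (i := i))).2.symm)
  have h' : tensorPower A n x x = ((∏ i, (A (x i) (x i)).re : ℝ) : ℂ) := by
    rw [tensorPower, Complex.ofReal_prod]
    exact Finset.prod_congr rfl fun i _ => h _
  rw [h', Complex.ofReal_re]

variable [Fintype ι]

lemma tensorPower_mul (A B : Matrix ι ι ℂ) (n : ℕ) :
    tensorPower (A * B) n = tensorPower A n * tensorPower B n := by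
  classical
  ext x y
  simp only [tensorPower, mul_apply, Finset.prod_univ_sum, Fintype.piFinset_univ,
    Finset.prod_mul_distrib]

variable [DecidableEq ι]

lemma tensorPower_spectralMatrix (U : Matrix ι ι ℂ) (f : ι → ℝ) (n : ℕ) :
    tensorPower (spectralMatrix U f) n =
      spectralMatrix (tensorPower U n) (fun x => ∏ i, f (x i)) := by
  rw [spectralMatrix, tensorPower_mul, tensorPower_mul, tensorPower_realDiagonal,
    tensorPower_conjTranspose, spectralMatrix]

lemma tensorPower_mul_conjTranspose {U : Matrix ι ι ℂ} (hU : U * Uᴴ = 1) (n : ℕ) :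
    tensorPower U n * (tensorPower U n)ᴴ = 1 := by
  have h1 : ∀ (m : Type _) [DecidableEq m], (1 : Matrix m m ℂ) = realDiagonal fun _ => 1 := by
    intro m _
    simp [realDiagonal]
  rw [← tensorPower_conjTranspose, ← tensorPower_mul, hU, h1, tensorPower_realDiagonal, h1]
  simp

end TensorPower

section TypicalSequences

variable {ι : Type*}

lemma logb_prod_eq_sum {p : ι → ℝ} {n : ℕ} {x : Fin n → ι} (h : 0 < ∏ i, p (x i)) :
    Real.logb 2 (∏ i, p (x i)) = ∑ i, Real.logb 2 (p (x i)) :=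
  Real.logb_prod _ _ fun i hi => (Finset.prod_ne_zero_iff.mp h.ne') i hi

variable [Fintype ι]

/-- A Chernoff-type weak law of large numbers for finite distributions. -/
lemma tendsto_sum_prod_of_mean_neg {p f : ι → ℝ} (hp : ∀ i, 0 ≤ p i) (hp1 : ∑ i, p i = 1)
    (hf : ∑ i, p i * f i < 0) :
    Tendsto (fun n : ℕ => ∑ x : Fin n → ι, if 0 ≤ ∑ i, f (x i) then ∏ i, p (x i) else 0)
      atTop (nhds 0) := by
  obtain ⟨s, hs, hs1⟩ : ∃ s : ℝ, 0 < s ∧ ∑ i, p i * Real.exp (s * f i) < 1 := by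
    have hd : HasDerivAt (fun s : ℝ => ∑ i, p i * Real.exp (s * f i)) (∑ i, p i * f i) 0 := by
      have : ∀ i ∈ Finset.univ, HasDerivAt (fun s : ℝ => p i * Real.exp (s * f i))
          (p i * f i) 0 := by
        intro i _
        have h := (((hasDerivAt_id (0 : ℝ)).mul_const (f i)).exp).const_mul (p i)
        simpa using h
      simpa using HasDerivAt.fun_sum this
    have hlt := (hd.tendsto_slope.mono_left (nhdsGT_le_nhdsNE 0)).eventually (gt_mem_nhds hf)
    obtain ⟨s, hs, hs0⟩ := (hlt.and self_mem_nhdsWithin).exists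
    refine ⟨s, hs0, ?_⟩
    have hs0' : (0 : ℝ) < s := hs0
    rw [slope_def_field, sub_zero, div_lt_iff₀ hs0', zero_mul] at hs
    simp only [zero_mul, Real.exp_zero, mul_one, hp1] at hs
    linarith
  have hm0 : 0 ≤ ∑ i, p i * Real.exp (s * f i) :=
    Finset.sum_nonneg fun i _ => mul_nonneg (hp i) (Real.exp_pos _).le
  refine squeeze_zero (fun n => Finset.sum_nonneg fun x _ => ?_) (fun n => ?_)
    (tendsto_pow_atTop_nhds_zero_of_lt_one hm0 hs1)
  · split_ifs
    · exact Finset.prod_nonneg fun i _ => hp _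
    · exact le_rfl
  · rw [Fintype.sum_pow]
    refine Finset.sum_le_sum fun x _ => ?_
    have hx : 0 ≤ ∏ i, p (x i) := Finset.prod_nonneg fun i _ => hp _
    rw [Finset.prod_mul_distrib, ← Real.exp_sum, ← Finset.mul_sum]
    split_ifs with h
    · exact le_mul_of_one_le_right hx (Real.one_le_exp (mul_nonneg hs.le h))
    · exact mul_nonneg hx (Real.exp_pos _).le

/-- The Shannon entropy in bits. -/
def shannonEntropy (p : ι → ℝ) : ℝ := -∑ i, p i * Real.logb 2 (p i)

lemma tendsto_sum_prod_lt {p : ι → ℝ} (hp : ∀ i, 0 ≤ p i) (hp1 : ∑ i, p i = 1) {δ : ℝ}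
    (hδ : 0 < δ) :
    Tendsto (fun n : ℕ => ∑ x : Fin n → ι,
      if ∏ i, p (x i) < (2 : ℝ) ^ (-((shannonEntropy p + δ) * n)) then ∏ i, p (x i) else 0)
      atTop (nhds 0) := by
  refine squeeze_zero (fun n => Finset.sum_nonneg fun x _ => ?_)
    (fun n => Finset.sum_le_sum fun x _ => ?_)
    (tendsto_sum_prod_of_mean_neg (f := fun i => -Real.logb 2 (p i) - (shannonEntropy p + δ))
      hp hp1 ?_)
  · split_ifs
    · exact Finset.prod_nonneg fun i _ => hp _
    · exact le_rfl
  · have hx : 0 ≤ ∏ i, p (x i) := Finset.prod_nonneg fun i _ => hp _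
    split_ifs with h1 h2 h2
    · exact le_rfl
    · rcases hx.eq_or_lt with h | h
      · exact h.symm.le
      · refine absurd ?_ h2
        have := Real.logb_lt_logb one_lt_two h h1
        rw [Real.logb_rpow two_pos (by norm_num), logb_prod_eq_sum h] at this
        simp only [Finset.sum_sub_distrib, Finset.sum_neg_distrib, Finset.sum_const,
          Finset.card_univ, Fintype.card_fin, nsmul_eq_mul]
        linarith
    · exact hx
    · exact le_rfl
  · simp only [mul_sub, mul_neg, Finset.sum_sub_distrib, Finset.sum_neg_distrib,
      ← Finset.sum_mul, hp1]
    rw [shannonEntropy]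
    linarith

lemma tendsto_sum_prod_gt {p : ι → ℝ} (hp : ∀ i, 0 ≤ p i) (hp1 : ∑ i, p i = 1) {δ : ℝ}
    (hδ : 0 < δ) :
    Tendsto (fun n : ℕ => ∑ x : Fin n → ι,
      if (2 : ℝ) ^ (-((shannonEntropy p - δ) * n)) < ∏ i, p (x i) then ∏ i, p (x i) else 0)
      atTop (nhds 0) := by
  refine squeeze_zero (fun n => Finset.sum_nonneg fun x _ => ?_)
    (fun n => Finset.sum_le_sum fun x _ => ?_)
    (tendsto_sum_prod_of_mean_neg (f := fun i => Real.logb 2 (p i) + (shannonEntropy p - δ))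
      hp hp1 ?_)
  · split_ifs
    · exact Finset.prod_nonneg fun i _ => hp _
    · exact le_rfl
  · have hx : 0 ≤ ∏ i, p (x i) := Finset.prod_nonneg fun i _ => hp _
    split_ifs with h1 h2 h2
    · exact le_rfl
    · refine absurd ?_ h2
      have h := (Real.rpow_pos_of_pos two_pos _).trans h1
      have := Real.logb_lt_logb one_lt_two (Real.rpow_pos_of_pos two_pos _) h1
      rw [Real.logb_rpow two_pos (by norm_num), logb_prod_eq_sum h] at this
      simp only [Finset.sum_add_distrib, Finset.sum_const, Finset.card_univ, Fintype.card_fin,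
        nsmul_eq_mul]
      linarith
    · exact hx
    · exact le_rfl
  · simp only [mul_add, Finset.sum_add_distrib, ← Finset.sum_mul, hp1]
    rw [shannonEntropy]
    linarith

lemma sum_prod_eq_one {p : ι → ℝ} (hp1 : ∑ i, p i = 1) (n : ℕ) :
    ∑ x : Fin n → ι, ∏ i, p (x i) = 1 := by
  rw [← Fintype.sum_pow, hp1, one_pow]

end TypicalSequences

section Rates

variable {ι : Type*} [Fintype ι] [DecidableEq ι] {U : Matrix ι ι ℂ} {l : ι → ℝ}

lemma one_le_floor_two_rpow {r : ℝ} (hr : 0 ≤ r) (n : ℕ) :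
    (1 : ℝ) ≤ ((⌊(2 : ℝ) ^ (r * n)⌋ : ℤ) : ℝ) := by
  have h : (1 : ℤ) ≤ ⌊(2 : ℝ) ^ (r * n)⌋ := by
    rw [Int.le_floor]
    push_cast
    exact Real.one_le_rpow one_le_two (by positivity)
  exact_mod_cast h

lemma FGamma_tpow_le_one (hU : U * Uᴴ = 1) (hl : ∀ i, 0 ≤ l i) (hl1 : ∑ i, l i = 1) (n : ℕ)
    {K : ℝ} (hK : 0 < K) : FGamma (tpow (diagEmbed (spectralMatrix U l)) n) K ≤ 1 := by
  rw [tpow_diagEmbed, tensorPower_spectralMatrix]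
  refine FGamma_diagEmbed_le hK fun G _ hG1 _ => ?_
  refine (re_trace_mul_le hG1 (spectralMatrix_posSemidef _ fun x =>
    Finset.prod_nonneg fun i _ => hl _)).trans (le_of_eq ?_)
  rw [re_trace_spectralMatrix (tensorPower_mul_conjTranspose hU n), sum_prod_eq_one hl1]

lemma FGamma_tpow_one (hU : U * Uᴴ = 1) (hl : ∀ i, 0 ≤ l i) (hl1 : ∑ i, l i = 1) (n : ℕ) :
    FGamma (tpow (diagEmbed (spectralMatrix U l)) n) 1 = 1 := by
  refine le_antisymm (FGamma_tpow_le_one hU hl hl1 n one_pos) ?_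
  rw [tpow_diagEmbed, tensorPower_spectralMatrix]
  have h := le_FGamma_diagEmbed (spectralMatrix_posSemidef (tensorPower U n)
    (f := fun x => ∏ i, l (x i)) fun x => Finset.prod_nonneg fun i _ => hl (x i)) one_pos
    PosSemidef.one (by simpa using PosSemidef.zero) (by simp)
  rwa [one_mul, re_trace_spectralMatrix (tensorPower_mul_conjTranspose hU n),
    sum_prod_eq_one hl1] at h

lemma sum_diag_re_spectralMatrix (hU : U * Uᴴ = 1) :
    ∑ i, (spectralMatrix U l i i).re = ∑ i, l i := by
  rw [← re_trace_spectralMatrix hU l]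
  simp [trace]

/-- Every rate below `H - S` is achievable. -/
lemma tendsto_FGamma_of_lt (hU : U * Uᴴ = 1) (hl : ∀ i, 0 ≤ l i) (hl1 : ∑ i, l i = 1) {r : ℝ}
    (hr : 0 ≤ r)
    (hrE : r < shannonEntropy (fun i => (spectralMatrix U l i i).re) - shannonEntropy l) :
    Tendsto (fun n : ℕ => FGamma (tpow (diagEmbed (spectralMatrix U l)) n)
      ((⌊(2 : ℝ) ^ (r * (n : ℝ))⌋ : ℤ) : ℝ)) atTop (nhds 1) := by
  set p : ι → ℝ := fun i => (spectralMatrix U l i i).re with hpdef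
  have hA := spectralMatrix_posSemidef U hl
  have hp : ∀ i, 0 ≤ p i := fun i => (Complex.le_def.mp (hA.diag_nonneg (i := i))).1
  have hp1 : ∑ i, p i = 1 := (sum_diag_re_spectralMatrix hU).trans hl1
  set δ := (shannonEntropy p - shannonEntropy l - r) / 2 with hδdef
  have hδ : 0 < δ := by rw [hδdef]; linarith
  have hlow := tendsto_sum_prod_lt hl hl1 hδ
  have hhigh := tendsto_sum_prod_gt hp hp1 hδ
  have hK : ∀ n : ℕ, (0 : ℝ) < ((⌊(2 : ℝ) ^ (r * (n : ℝ))⌋ : ℤ) : ℝ) := fun n =>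
    one_pos.trans_le (one_le_floor_two_rpow hr n)
  rw [tendsto_order]
  refine ⟨fun c hc => ?_, fun c hc => Eventually.of_forall fun n =>
    (FGamma_tpow_le_one hU hl hl1 n (hK n)).trans_lt hc⟩
  obtain ⟨s, hs, hsc⟩ : ∃ s : ℝ, 0 < s ∧ (1 + s ^ 2) * c < 1 := by
    refine ⟨√((1 - c) / 2), Real.sqrt_pos.mpr (by linarith), ?_⟩
    rw [Real.sq_sqrt (by linarith)]
    nlinarith
  have hlim := (hlow.const_sub 1).sub (hhigh.const_mul (1 + (s⁻¹) ^ 2))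
  rw [mul_zero, sub_zero, sub_zero] at hlim
  filter_upwards [hlim.eventually (lt_mem_nhds hsc)] with n hn
  obtain ⟨G, hG, hG1, hGd, hGt⟩ := exists_re_trace_mul_spectralMatrix_ge
    (tensorPower_mul_conjTranspose hU n) (l := fun x => ∏ i, l (x i))
    (fun x => Finset.prod_nonneg fun i _ => hl _)
    (Real.rpow_pos_of_pos two_pos (-((shannonEntropy l + δ) * n)))
    (Real.rpow_pos_of_pos two_pos (-((shannonEntropy p - δ) * n))).le hs.ne'
  rw [← tensorPower_spectralMatrix] at hGt
  simp only [tensorPower_diag_re hA] at hGt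
  have hF : ((G * tensorPower (spectralMatrix U l) n).trace).re ≤
      FGamma (tpow (diagEmbed (spectralMatrix U l)) n)
        ((⌊(2 : ℝ) ^ (r * (n : ℝ))⌋ : ℤ) : ℝ) := by
    rw [tpow_diagEmbed]
    refine le_FGamma_diagEmbed ?_ (hK n) hG hG1 fun x => (hGd x).trans ?_
    · rw [tensorPower_spectralMatrix]
      exact spectralMatrix_posSemidef _ fun x => Finset.prod_nonneg fun i _ => hl _
    · rw [← Real.rpow_sub two_pos]
      refine le_trans (le_of_eq ?_) (one_div_le_one_div_of_le (hK n) (Int.floor_le _))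
      rw [one_div, ← Real.rpow_neg two_pos.le]
      congr 1
      rw [hδdef]
      ring
  have hsum : (∑ y : Fin n → ι, if (2 : ℝ) ^ (-((shannonEntropy l + δ) * n)) ≤ ∏ i, l (y i)
      then ∏ i, l (y i) else 0) = 1 - ∑ y : Fin n → ι,
        if ∏ i, l (y i) < (2 : ℝ) ^ (-((shannonEntropy l + δ) * n)) then ∏ i, l (y i) else 0 := by
    rw [← sum_prod_eq_one hl1 n, ← Finset.sum_sub_distrib]
    refine Finset.sum_congr rfl fun y _ => ?_
    by_cases h : ∏ i, l (y i) < (2 : ℝ) ^ (-((shannonEntropy l + δ) * n))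
    · simp [h, not_le.mpr h]
    · simp [h, not_lt.mp h]
  rw [hsum] at hGt
  have h1 := hn.trans_le hGt
  have h2 : c < ((G * tensorPower (spectralMatrix U l) n).trace).re :=
    lt_of_mul_lt_mul_left h1 (by positivity)
  exact h2.trans_le hF

/-- Strong converse: above the rate `H - S` the fidelity tends to zero. -/
lemma tendsto_FGamma_of_gt (hU : U * Uᴴ = 1) (hl : ∀ i, 0 ≤ l i) (hl1 : ∑ i, l i = 1) {r : ℝ}
    (hr : 0 ≤ r)
    (hrE : shannonEntropy (fun i => (spectralMatrix U l i i).re) - shannonEntropy l < r) :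
    ∃ c : ℕ → ℝ, Tendsto c atTop (nhds 0) ∧
      ∀ n : ℕ, FGamma (tpow (diagEmbed (spectralMatrix U l)) n)
        ((⌊(2 : ℝ) ^ (r * (n : ℝ))⌋ : ℤ) : ℝ) ≤ c n := by
  set p : ι → ℝ := fun i => (spectralMatrix U l i i).re with hpdef
  have hA := spectralMatrix_posSemidef U hl
  have hp : ∀ i, 0 ≤ p i := fun i => (Complex.le_def.mp (hA.diag_nonneg (i := i))).1
  have hp1 : ∑ i, p i = 1 := (sum_diag_re_spectralMatrix hU).trans hl1
  set δ := (r - (shannonEntropy p - shannonEntropy l)) / 3 with hδdef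
  have hδ : 0 < δ := by rw [hδdef]; linarith
  have hlow := tendsto_sum_prod_lt hp hp1 hδ
  have hhigh := tendsto_sum_prod_gt hl hl1 hδ
  have hgeom : Tendsto (fun n : ℕ => 2 * (2 * ((2 : ℝ) ^ (-δ)) ^ n)) atTop (nhds 0) := by
    have h := tendsto_pow_atTop_nhds_zero_of_lt_one
      (Real.rpow_pos_of_pos two_pos (-δ)).le
      (Real.rpow_lt_one_of_one_lt_of_neg one_lt_two (neg_lt_zero.mpr hδ))
    simpa using (h.const_mul 2).const_mul 2
  have hlim := (hhigh.add (hlow.const_mul 2)).add hgeom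
  rw [mul_zero, add_zero, add_zero] at hlim
  refine ⟨_, hlim, fun n => ?_⟩
  have hK := one_le_floor_two_rpow hr n
  have hK0 := one_pos.trans_le hK
  have hKhalf : (2 : ℝ) ^ (r * n) ≤ 2 * ((⌊(2 : ℝ) ^ (r * (n : ℝ))⌋ : ℤ) : ℝ) := by
    have := Int.lt_floor_add_one ((2 : ℝ) ^ (r * (n : ℝ)))
    linarith
  rw [tpow_diagEmbed]
  refine FGamma_diagEmbed_le hK0 fun G hG hG1 hGd => ?_
  have h := re_trace_mul_spectralMatrix_le (tensorPower_mul_conjTranspose hU n)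
    (l := fun x => ∏ i, l (x i)) (fun x => Finset.prod_nonneg fun i _ => hl _)
    (sum_prod_eq_one hl1 n) hG hG1 (one_div_pos.mpr hK0).le
    (Real.rpow_pos_of_pos two_pos (-((shannonEntropy l - δ) * n))).le
    (Real.rpow_pos_of_pos two_pos (-((shannonEntropy p + δ) * n))) hGd
  rw [← tensorPower_spectralMatrix] at h
  simp only [tensorPower_diag_re hA] at h
  refine h.trans (add_le_add le_rfl (mul_le_mul_of_nonneg_left ?_ two_pos.le))
  have hinv : 1 / ((⌊(2 : ℝ) ^ (r * (n : ℝ))⌋ : ℤ) : ℝ) ≤ 2 * (2 : ℝ) ^ (-(r * n)) := by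
    rw [Real.rpow_neg two_pos.le, div_le_iff₀ hK0]
    have hpos := Real.rpow_pos_of_pos two_pos (r * n)
    rw [mul_assoc, inv_mul_eq_div, ← mul_div_assoc, le_div_iff₀ hpos, one_mul]
    exact hKhalf
  calc (2 : ℝ) ^ (-((shannonEntropy l - δ) * n)) *
        (1 / ((⌊(2 : ℝ) ^ (r * (n : ℝ))⌋ : ℤ) : ℝ)) / (2 : ℝ) ^ (-((shannonEntropy p + δ) * n))
      ≤ (2 : ℝ) ^ (-((shannonEntropy l - δ) * n)) * (2 * (2 : ℝ) ^ (-(r * n))) /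
          (2 : ℝ) ^ (-((shannonEntropy p + δ) * n)) := by gcongr
    _ = 2 * (2 : ℝ) ^ (-((shannonEntropy l - δ) * n) + -(r * n) -
          -((shannonEntropy p + δ) * n)) := by
        rw [Real.rpow_sub two_pos, Real.rpow_add two_pos]
        ring
    _ = 2 * ((2 : ℝ) ^ (-δ)) ^ n := by
        rw [← Real.rpow_natCast, ← Real.rpow_mul two_pos.le]
        congr 2
        rw [hδdef]
        ring

lemma DGamma_diagEmbed (hU : U * Uᴴ = 1) (hl : ∀ i, 0 ≤ l i) (hl1 : ∑ i, l i = 1) :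
    DGamma (diagEmbed (spectralMatrix U l)) =
      shannonEntropy (fun i => (spectralMatrix U l i i).re) - shannonEntropy l := by
  set E := shannonEntropy (fun i => (spectralMatrix U l i i).re) - shannonEntropy l with hE
  have hzero : (0 : ℝ) ∈ {r : ℝ | 0 ≤ r ∧ Tendsto (fun n : ℕ =>
      FGamma (tpow (diagEmbed (spectralMatrix U l)) n)
        ((⌊(2 : ℝ) ^ (r * (n : ℝ))⌋ : ℤ) : ℝ)) atTop (nhds 1)} := by
    refine ⟨le_rfl, ?_⟩
    simp [FGamma_tpow_one hU hl hl1]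
  refine csSup_eq_of_forall_le_of_forall_lt_exists_gt ⟨0, hzero⟩ ?_ ?_
  · rintro r ⟨hr, hlim⟩
    by_contra! hrE
    obtain ⟨c, hc, hle⟩ := tendsto_FGamma_of_gt hU hl hl1 hr hrE
    exact absurd (le_of_tendsto_of_tendsto' hlim hc hle) (by norm_num)
  · intro w hw
    rcases lt_or_ge w 0 with h | h
    · exact ⟨0, hzero, h⟩
    · exact ⟨(w + E) / 2, ⟨by linarith, tendsto_FGamma_of_lt hU hl hl1 (by linarith)
        (by linarith)⟩, by linarith⟩

end Rates

/-- The p.p.t. distillable entanglement of a maximally correlated state `ρ_α` is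
`H(α₁₁,…,α_kk) - S(α)`. -/
theorem DGamma_maxCorr {k : ℕ} (α : Matrix (Fin k) (Fin k) ℂ)
    (hα : α.PosSemidef) (hαtr : α.trace = 1) :
    DGamma (maxCorr α) =
      (- ∑ i, (α i i).re * Real.logb 2 (α i i).re) -
        (- ∑ i, hα.1.eigenvalues i * Real.logb 2 (hα.1.eigenvalues i)) := by
  have hU : (hα.1.eigenvectorUnitary : Matrix (Fin k) (Fin k) ℂ) *
      (hα.1.eigenvectorUnitary : Matrix (Fin k) (Fin k) ℂ)ᴴ = 1 :=
    Unitary.coe_mul_star_self hα.1.eigenvectorUnitary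
  have hspec : spectralMatrix (hα.1.eigenvectorUnitary : Matrix (Fin k) (Fin k) ℂ)
      hα.1.eigenvalues = α := by
    conv_rhs => rw [hα.1.spectral_theorem, Unitary.conjStarAlgAut_apply]
    rfl
  have hsum : ∑ i, hα.1.eigenvalues i = 1 := by
    have h := hα.1.trace_eq_sum_eigenvalues
    rw [hαtr] at h
    simpa using (congrArg Complex.re h).symm
  have h := DGamma_diagEmbed hU (fun i => hα.eigenvalues_nonneg i) hsum
  rw [hspec] at h
  exact h
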